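/- Let w be a weight on ℝ and let δ > 1. Assume the Fujii–Wilson condition with constant δ: for every bounded interval I, ∫_I M(w·1_I) dx ≤ δ·w(I). Then for every bounded interval I and every exponent r with 1 ≤ r < δ/(δ−1), one has (1/|I|)∫_I wʳ dx ≤ δ · (r′−1)/(r′−δ) · ((1/|I|)∫_I w dx)ʳ. -/

import Mathlib

open MeasureTheory Set ENNReal

noncomputable section

/-- The non-centered Hardy–Littlewood maximal operator on `ℝ`, as a supremum of
averages over bounded open intervals containing the point. -/
def M1 (f : ℝ → ℝ) (x : ℝ) : ℝ≥0∞ :=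
  ⨆ (a : ℝ) (b : ℝ) (_ : a < b) (_ : x ∈ Set.Ioo a b),
    (∫⁻ y in Set.Ioo a b, ENNReal.ofReal |f y|) / volume (Set.Ioo a b)

lemma average_le_M1 (f : ℝ → ℝ) {a b x : ℝ} (hx : x ∈ Ioo a b) :
    (∫⁻ y in Ioo a b, ENNReal.ofReal |f y|) / volume (Ioo a b) ≤ M1 f x :=
  le_iSup₂_of_le a b (le_iSup₂_of_le (hx.1.trans hx.2) hx le_rfl)

lemma lt_M1_iff {f : ℝ → ℝ} {x : ℝ} {t : ℝ≥0∞} :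
    t < M1 f x ↔ ∃ a b, x ∈ Ioo a b ∧
      t < (∫⁻ y in Ioo a b, ENNReal.ofReal |f y|) / volume (Ioo a b) := by
  refine ⟨fun h => ?_, fun ⟨a, b, hx, h⟩ => h.trans_le (average_le_M1 f hx)⟩
  simp only [M1, lt_iSup_iff] at h
  obtain ⟨a, b, -, hx, h⟩ := h
  exact ⟨a, b, hx, h⟩

lemma isOpen_lt_M1 (f : ℝ → ℝ) (t : ℝ≥0∞) : IsOpen {x | t < M1 f x} := by
  rw [isOpen_iff_forall_mem_open]
  intro x hx
  obtain ⟨a, b, hxab, h⟩ := lt_M1_iff.1 hx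
  exact ⟨Ioo a b, fun y hy => lt_M1_iff.2 ⟨a, b, hy, h⟩, isOpen_Ioo, hxab⟩

lemma measurable_M1 (f : ℝ → ℝ) : Measurable (M1 f) :=
  measurable_of_Ioi fun t => (isOpen_lt_M1 f t).measurableSet

lemma setLIntegral_abs_indicator {w : ℝ → ℝ} (hw : ∀ x, 0 ≤ w x) {s : Set ℝ}
    (hs : MeasurableSet s) (u : Set ℝ) :
    ∫⁻ y in u, ENNReal.ofReal |s.indicator w y| = ∫⁻ y in s ∩ u, ENNReal.ofReal (w y) := by
  rw [← Measure.restrict_restrict hs, ← lintegral_indicator hs]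
  refine lintegral_congr fun y => ?_
  by_cases hy : y ∈ s <;> simp [hy, abs_of_nonneg (hw y)]

/-- The components of an open subset of a bounded interval are open intervals with endpoints
outside the set. -/
lemma exists_connectedComponentIn_eq_Ioo {U : Set ℝ} (hU : IsOpen U) {a b x : ℝ}
    (hUab : U ⊆ Ioo a b) (hx : x ∈ U) :
    ∃ c d, c < d ∧ a ≤ c ∧ d ≤ b ∧ connectedComponentIn U x = Ioo c d ∧ c ∉ U ∧ d ∉ U := by
  set J := connectedComponentIn U x with hJ
  have hJo : IsOpen J := hU.connectedComponentIn
  have hJc : IsConnected J := isConnected_connectedComponentIn_iff.2 hx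
  have hJU : J ⊆ U := connectedComponentIn_subset U x
  have hxJ : x ∈ J := mem_connectedComponentIn hx
  have hJb : BddBelow J := bddBelow_Ioo.mono (hJU.trans hUab)
  have hJa : BddAbove J := bddAbove_Ioo.mono (hJU.trans hUab)
  have hEq : J = Ioo (sInf J) (sSup J) := by
    refine Subset.antisymm ?_ (hJc.Ioo_csInf_csSup_subset hJb hJa)
    rw [← interior_Icc]
    exact interior_maximal (subset_Icc_csInf_csSup hJb hJa) hJo
  have hxI : x ∈ Ioo (sInf J) (sSup J) := hEq ▸ hxJ
  refine ⟨sInf J, sSup J, hxI.1.trans hxI.2, le_csInf ⟨x, hxJ⟩ fun y hy => (hUab (hJU hy)).1.le,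
    csSup_le ⟨x, hxJ⟩ fun y hy => (hUab (hJU hy)).2.le, hEq, fun h => ?_, fun h => ?_⟩
  · have hs : Ico (sInf J) (sSup J) ⊆ J := by
      refine isPreconnected_Ico.subset_connectedComponentIn ⟨hxI.1.le, hxI.2⟩ fun y hy => ?_
      rcases hy.1.eq_or_lt with rfl | h'
      · exact h
      · exact hJU (hEq ▸ ⟨h', hy.2⟩)
    have := hs ⟨le_rfl, hxI.1.trans hxI.2⟩
    exact lt_irrefl _ (hEq.subset this).1
  · have hs : Ioc (sInf J) (sSup J) ⊆ J := by
      refine isPreconnected_Ioc.subset_connectedComponentIn ⟨hxI.1, hxI.2.le⟩ fun y hy => ?_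
      rcases hy.2.eq_or_lt with rfl | h'
      · exact h
      · exact hJU (hEq ▸ ⟨hy.1, h'⟩)
    have := hs ⟨hxI.1.trans hxI.2, le_rfl⟩
    exact lt_irrefl _ (hEq.subset this).2

lemma setLIntegral_le_of_connectedComponentIn {U : Set ℝ} (hU : IsOpen U) {f g : ℝ → ℝ≥0∞}
    (h : ∀ x ∈ U, ∫⁻ y in connectedComponentIn U x, f y ≤ ∫⁻ y in connectedComponentIn U x, g y) :
    ∫⁻ y in U, f y ≤ ∫⁻ y in U, g y := by
  set T : Set (Set ℝ) := connectedComponentIn U '' U with hT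
  have hopen : ∀ J ∈ T, IsOpen J := by
    rintro _ ⟨x, -, rfl⟩
    exact hU.connectedComponentIn
  have hdisj : T.PairwiseDisjoint id := by
    rintro _ ⟨x, hx, rfl⟩ _ ⟨y, hy, rfl⟩ hne
    refine Set.disjoint_left.2 fun z hzx hzy => hne ?_
    rw [connectedComponentIn_eq hzx, connectedComponentIn_eq hzy]
  have hcount : T.Countable := hdisj.countable_of_isOpen hopen <| by
    rintro _ ⟨x, hx, rfl⟩
    exact ⟨x, mem_connectedComponentIn hx⟩
  have hUT : U = ⋃ J ∈ T, J := by
    ext x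
    simp only [hT, mem_iUnion, exists_prop, exists_mem_image]
    exact ⟨fun hx => ⟨x, hx, mem_connectedComponentIn hx⟩,
      fun ⟨y, _, hxy⟩ => connectedComponentIn_subset U y hxy⟩
  have hsum : ∀ f : ℝ → ℝ≥0∞, ∫⁻ y in U, f y = ∑' J : T, ∫⁻ y in (J : Set ℝ), f y := fun f => by
    conv_lhs => rw [hUT]
    exact lintegral_biUnion hcount (fun J hJ => (hopen J hJ).measurableSet) hdisj f
  rw [hsum, hsum]
  refine ENNReal.tsum_le_tsum ?_
  rintro ⟨_, x, hx, rfl⟩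
  exact h x hx

/-- On a component of a superlevel set, the maximal function is determined by the restriction
of the weight to that component. -/
lemma M1_indicator_le_of_mem_component {w : ℝ → ℝ} (hw : ∀ x, 0 ≤ w x) {a b x : ℝ} {t : ℝ≥0∞}
    (hx : x ∈ Ioo a b ∩ {x | t < M1 ((Ioo a b).indicator w) x}) {c d : ℝ}
    (hcd : connectedComponentIn (Ioo a b ∩ {x | t < M1 ((Ioo a b).indicator w) x}) x = Ioo c d) :
    M1 ((Ioo a b).indicator w) x ≤ M1 ((Ioo c d).indicator w) x := by
  refine le_of_forall_lt fun s hs => ?_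
  obtain ⟨p, q, hpq, h⟩ := lt_M1_iff.1 (max_lt hs hx.2)
  have hsub : Ioo a b ∩ Ioo p q ⊆ Ioo c d := by
    rw [← hcd, Ioo_inter_Ioo]
    refine isPreconnected_Ioo.subset_connectedComponentIn ?_ ?_ <;> rw [← Ioo_inter_Ioo]
    · exact ⟨hx.1, hpq⟩
    · exact fun y hy => ⟨hy.1, lt_M1_iff.2 ⟨p, q, hy.2, (le_max_right _ _).trans_lt h⟩⟩
  refine lt_M1_iff.2 ⟨p, q, hpq, (le_max_left _ _).trans_lt (h.trans_le ?_)⟩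
  rw [setLIntegral_abs_indicator hw measurableSet_Ioo,
    setLIntegral_abs_indicator hw measurableSet_Ioo]
  exact ENNReal.div_le_div_right (lintegral_mono_set (subset_inter hsub inter_subset_right)) _

lemma setLIntegral_le_of_average_le {f : ℝ → ℝ≥0∞} {p q : ℝ} (hpq : p < q) {t : ℝ≥0∞}
    (h : (∫⁻ y in Ioo p q, f y) / volume (Ioo p q) ≤ t) :
    ∫⁻ y in Ioo p q, f y ≤ t * ENNReal.ofReal (q - p) := by
  rw [Real.volume_Ioo] at h
  rwa [ENNReal.div_le_iff (by simpa using hpq) ENNReal.ofReal_ne_top] at h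

lemma setLIntegral_Ioo_le_of_M1_le_left {f : ℝ → ℝ} {c d t : ℝ} (hcd : c < d)
    (h : M1 f c ≤ ENNReal.ofReal t) :
    ∫⁻ y in Ioo c d, ENNReal.ofReal |f y| ≤ ENNReal.ofReal t * ENNReal.ofReal (d - c) := by
  have hlim : Filter.Tendsto (fun ε : ℝ => ENNReal.ofReal t * ENNReal.ofReal (d - (c - ε)))
      (nhdsWithin 0 (Ioi 0)) (nhds (ENNReal.ofReal t * ENNReal.ofReal (d - c))) := by
    refine ENNReal.Tendsto.const_mul ?_ (Or.inr ENNReal.ofReal_ne_top)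
    have : Continuous fun ε : ℝ => ENNReal.ofReal (d - (c - ε)) :=
      ENNReal.continuous_ofReal.comp (by fun_prop)
    simpa using (this.tendsto 0).mono_left nhdsWithin_le_nhds
  refine ge_of_tendsto hlim ?_
  filter_upwards [self_mem_nhdsWithin] with ε hε
  have hε : 0 < ε := hε
  calc ∫⁻ y in Ioo c d, ENNReal.ofReal |f y|
      ≤ ∫⁻ y in Ioo (c - ε) d, ENNReal.ofReal |f y| :=
        lintegral_mono_set (Ioo_subset_Ioo_left (by linarith))
    _ ≤ _ := setLIntegral_le_of_average_le (by linarith)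
        ((average_le_M1 f ⟨by linarith, hcd⟩).trans h)

lemma setLIntegral_Ioo_le_of_M1_le_right {f : ℝ → ℝ} {c d t : ℝ} (hcd : c < d)
    (h : M1 f d ≤ ENNReal.ofReal t) :
    ∫⁻ y in Ioo c d, ENNReal.ofReal |f y| ≤ ENNReal.ofReal t * ENNReal.ofReal (d - c) := by
  have hlim : Filter.Tendsto (fun ε : ℝ => ENNReal.ofReal t * ENNReal.ofReal (d + ε - c))
      (nhdsWithin 0 (Ioi 0)) (nhds (ENNReal.ofReal t * ENNReal.ofReal (d - c))) := by
    refine ENNReal.Tendsto.const_mul ?_ (Or.inr ENNReal.ofReal_ne_top)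
    have : Continuous fun ε : ℝ => ENNReal.ofReal (d + ε - c) :=
      ENNReal.continuous_ofReal.comp (by fun_prop)
    simpa using (this.tendsto 0).mono_left nhdsWithin_le_nhds
  refine ge_of_tendsto hlim ?_
  filter_upwards [self_mem_nhdsWithin] with ε hε
  have hε : 0 < ε := hε
  calc ∫⁻ y in Ioo c d, ENNReal.ofReal |f y|
      ≤ ∫⁻ y in Ioo c (d + ε), ENNReal.ofReal |f y| :=
        lintegral_mono_set (Ioo_subset_Ioo_right (by linarith))
    _ ≤ _ := setLIntegral_le_of_average_le (by linarith)
        ((average_le_M1 f ⟨hcd, by linarith⟩).trans h)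

/-- Under the Fujii–Wilson condition, the maximal function has mean at most `δ * t` over its
superlevel set at any height `t` above the average of the weight. -/
lemma setLIntegral_lt_M1_le {w : ℝ → ℝ} (hw : ∀ x, 0 ≤ w x) {δ : ℝ}
    (hFW : ∀ a b : ℝ, a < b →
      (∫⁻ x in Ioo a b, M1 ((Ioo a b).indicator w) x) ≤
        ENNReal.ofReal δ * ∫⁻ x in Ioo a b, ENNReal.ofReal (w x))
    {a b t : ℝ}
    (ht : (∫⁻ x in Ioo a b, ENNReal.ofReal (w x)) / volume (Ioo a b) ≤ ENNReal.ofReal t) :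
    ∫⁻ x in Ioo a b ∩ {x | ENNReal.ofReal t < M1 ((Ioo a b).indicator w) x},
        M1 ((Ioo a b).indicator w) x ≤
      ENNReal.ofReal δ * ENNReal.ofReal t *
        volume (Ioo a b ∩ {x | ENNReal.ofReal t < M1 ((Ioo a b).indicator w) x}) := by
  set f := (Ioo a b).indicator w with hf
  set U := Ioo a b ∩ {x | ENNReal.ofReal t < M1 f x} with hU
  have hUo : IsOpen U := isOpen_Ioo.inter (isOpen_lt_M1 f _)
  rw [← setLIntegral_const]
  refine setLIntegral_le_of_connectedComponentIn hUo fun x hx => ?_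
  obtain ⟨c, d, hcd, hac, hdb, hJ, hcU, hdU⟩ :=
    exists_connectedComponentIn_eq_Ioo hUo inter_subset_left hx
  have hfw : ∫⁻ y in Ioo c d, ENNReal.ofReal |f y| = ∫⁻ y in Ioo c d, ENNReal.ofReal (w y) := by
    rw [hf, setLIntegral_abs_indicator hw measurableSet_Ioo,
      inter_eq_right.2 (Ioo_subset_Ioo hac hdb)]
  have hmean : ∫⁻ y in Ioo c d, ENNReal.ofReal (w y) ≤
      ENNReal.ofReal t * ENNReal.ofReal (d - c) := by
    rcases hac.eq_or_lt with rfl | hac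
    · rcases hdb.eq_or_lt with rfl | hdb
      · exact setLIntegral_le_of_average_le hcd ht
      · rw [← hfw]
        exact setLIntegral_Ioo_le_of_M1_le_right hcd
          (not_lt.1 fun h => hdU ⟨⟨hcd, hdb⟩, h⟩)
    · rw [← hfw]
      exact setLIntegral_Ioo_le_of_M1_le_left hcd
        (not_lt.1 fun h => hcU ⟨⟨hac, hcd.trans_le hdb⟩, h⟩)
  rw [hJ]
  calc ∫⁻ y in Ioo c d, M1 f y
      ≤ ∫⁻ y in Ioo c d, M1 ((Ioo c d).indicator w) y := by
        refine setLIntegral_mono' measurableSet_Ioo fun y hy => ?_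
        have hyJ : y ∈ connectedComponentIn U x := hJ ▸ hy
        exact M1_indicator_le_of_mem_component hw (connectedComponentIn_subset U x hyJ)
          (by rw [← hJ, connectedComponentIn_eq hyJ])
    _ ≤ ENNReal.ofReal δ * ∫⁻ y in Ioo c d, ENNReal.ofReal (w y) := hFW c d hcd
    _ ≤ ENNReal.ofReal δ * (ENNReal.ofReal t * ENNReal.ofReal (d - c)) := by gcongr
    _ = ∫⁻ _ in Ioo c d, ENNReal.ofReal δ * ENNReal.ofReal t := by
        rw [setLIntegral_const, Real.volume_Ioo, mul_assoc]

lemma ae_ofReal_le_M1_indicator {w : ℝ → ℝ} (hw : ∀ x, 0 ≤ w x)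
    (hloc : LocallyIntegrable w volume) (a b : ℝ) :
    ∀ᵐ x ∂volume.restrict (Ioo a b), ENNReal.ofReal (w x) ≤ M1 ((Ioo a b).indicator w) x := by
  rw [ae_restrict_iff' measurableSet_Ioo]
  filter_upwards [IsUnifLocDoublingMeasure.ae_tendsto_average volume hloc 1] with x hx hxab
  have hlim := hx (l := nhdsWithin (0 : ℝ) (Ioi 0)) (fun _ => x) id Filter.tendsto_id
    (by filter_upwards [self_mem_nhdsWithin] with ε hε using
      by simpa using (show (0 : ℝ) < ε from hε).le)
  refine le_of_tendsto ((ENNReal.continuous_ofReal.tendsto _).comp hlim) ?_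
  have h1 : Ioo (a - x) (x - a) ∩ Ioo (x - b) (b - x) ∈ nhdsWithin (0 : ℝ) (Ioi 0) := by
    refine nhdsWithin_le_nhds (Filter.inter_mem (Ioo_mem_nhds ?_ ?_) (Ioo_mem_nhds ?_ ?_)) <;>
      linarith [hxab.1, hxab.2]
  filter_upwards [self_mem_nhdsWithin, h1] with ε hε hεab
  have hε : 0 < ε := hε
  refine le_trans (le_of_eq ?_)
    (average_le_M1 _ (show x ∈ Ioo (x - ε) (x + ε) from ⟨by linarith, by linarith⟩))
  have hint : IntegrableOn w (Ioo (x - ε) (x + ε)) :=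
    (hloc.integrableOn_isCompact isCompact_Icc).mono_set Ioo_subset_Icc_self
  have hsub : Ioo (x - ε) (x + ε) ⊆ Ioo a b :=
    Ioo_subset_Ioo (by linarith [hεab.1.2]) (by linarith [hεab.2.2])
  rw [setLIntegral_abs_indicator hw measurableSet_Ioo, inter_eq_right.2 hsub,
    ← ofReal_integral_eq_lintegral_ofReal hint (ae_of_all _ hw), Real.volume_Ioo,
    ← ENNReal.ofReal_div_of_pos (by linarith), Function.comp_apply, id, Real.closedBall_eq_Icc,
    setAverage_eq, integral_Icc_eq_integral_Ioo, Real.volume_real_Icc_of_le (by linarith),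
    smul_eq_mul, inv_mul_eq_div]

/-- Self-improvement: a bounded function whose mean over each superlevel set `{t < g}` with
`A ≤ t` is at most `δ * t` satisfies a reverse Hölder inequality. -/
lemma integral_rpow_le_of_setLIntegral_lt_le {α : Type*} [MeasurableSpace α] (μ : Measure α)
    [IsFiniteMeasure μ] {g : α → ℝ} (hg : Measurable g) {A N δ r : ℝ} (hA : 0 < A)
    (hAg : ∀ x, A ≤ g x) (hgN : ∀ x, g x ≤ N) (hδ : 0 ≤ δ) (hr : 1 ≤ r)
    (hδr : 0 < δ - (δ - 1) * r)
    (hmean : ∫ x, g x ∂μ ≤ δ * A * μ.real univ)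
    (hlevel : ∀ t, A ≤ t → ∫⁻ x in {x | t < g x}, ENNReal.ofReal (g x) ∂μ ≤
      ENNReal.ofReal δ * ENNReal.ofReal t * μ {x | t < g x}) :
    ∫ x, g x ^ r ∂μ ≤ δ * (1 / (δ - (δ - 1) * r)) * (A ^ r * μ.real univ) := by
  have hg0 : ∀ x, 0 < g x := fun x => hA.trans_le (hAg x)
  have hint : ∀ s : ℝ, 0 ≤ s → Integrable (fun x => g x ^ s) μ := fun s hs => by
    refine Integrable.of_bound (hg.pow_const s).aestronglyMeasurable (N ^ s)
      (ae_of_all _ fun x => ?_)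
    rw [Real.norm_of_nonneg (Real.rpow_nonneg (hg0 x).le s)]
    exact Real.rpow_le_rpow (hg0 x).le (hgN x) hs
  have hcont : ∀ s T : ℝ, 0 ≤ T → ContinuousOn (fun t : ℝ => (t + A) ^ s) (uIcc 0 T) :=
    fun s T hT => by
    refine ContinuousOn.rpow_const (by fun_prop) fun t ht => Or.inl ?_
    rw [uIcc_of_le hT] at ht
    linarith [ht.1]
  have hprim : ∀ s : ℝ, 0 < s → ∀ x, ∫ t in (0 : ℝ)..(g x - A), s * (t + A) ^ (s - 1) =
      g x ^ s - A ^ s := fun s hs x => by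
    have hT : 0 ≤ g x - A := sub_nonneg.2 (hAg x)
    rw [intervalIntegral.integral_eq_sub_of_hasDerivAt (f := fun t => (t + A) ^ s)]
    · simp
    · intro t ht
      rw [uIcc_of_le hT] at ht
      have := ((hasDerivAt_id t).add_const A).rpow_const (p := s)
        (Or.inl (by simp only [id]; linarith [ht.1]))
      simpa using this
    · exact (continuousOn_const.mul (hcont _ _ hT)).intervalIntegrable
  have hcake : ∀ (ν : Measure α) (s : ℝ), 0 < s →
      ∫⁻ x, ENNReal.ofReal (g x ^ s - A ^ s) ∂ν =
        ∫⁻ t in Ioi (0 : ℝ), ν {x | t + A < g x} * ENNReal.ofReal (s * (t + A) ^ (s - 1)) := by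
    intro ν s hs
    have := lintegral_comp_eq_lintegral_meas_lt_mul ν (f := fun x => g x - A)
      (g := fun t => s * (t + A) ^ (s - 1)) (ae_of_all _ fun x => sub_nonneg.2 (hAg x))
      (hg.sub_const A).aemeasurable
      (fun t ht => (continuousOn_const.mul (hcont _ _ ht.le)).intervalIntegrable)
      (by
        filter_upwards [ae_restrict_mem measurableSet_Ioi] with t ht
        have ht : 0 < t := ht
        positivity)
    simpa only [hprim s hs, lt_sub_iff_add_lt] using this
  rcases hr.eq_or_lt with rfl | hr
  · simpa [mul_assoc] using hmean
  have hr0 : 0 < r := by linarith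
  have hr1 : 0 < r - 1 := by linarith
  have hmono : ∀ s : ℝ, 0 ≤ s → ∀ x, 0 ≤ g x ^ s - A ^ s := fun s hs x =>
    sub_nonneg.2 (Real.rpow_le_rpow hA.le (hAg x) hs)
  have hI1 : Integrable (fun x => g x) μ := by simpa using hint 1 zero_le_one
  have hsplit : ∀ x, g x * (g x ^ (r - 1) - A ^ (r - 1)) = g x ^ r - A ^ (r - 1) * g x :=
    fun x => by
    rw [mul_sub, mul_comm (g x) (g x ^ (r - 1)), ← Real.rpow_add_one (hg0 x).ne']
    ring_nf
  have hI2 : Integrable (fun x => g x ^ r - A ^ (r - 1) * g x) μ :=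
    (hint r hr0.le).sub (hI1.const_mul _)
  have hI3 : Integrable (fun x => g x ^ r - A ^ r) μ := (hint r hr0.le).sub (integrable_const _)
  have key : ENNReal.ofReal (∫ x, (g x ^ r - A ^ (r - 1) * g x) ∂μ) ≤
      ENNReal.ofReal (δ * (r - 1) / r * ∫ x, (g x ^ r - A ^ r) ∂μ) := by
    rw [ENNReal.ofReal_mul (by positivity),
      ofReal_integral_eq_lintegral_ofReal hI2
        (ae_of_all _ fun x => by
          simp only [Pi.zero_apply, ← hsplit]
          exact mul_nonneg (hg0 x).le (hmono _ hr1.le x)),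
      ofReal_integral_eq_lintegral_ofReal hI3 (ae_of_all _ (hmono r hr0.le))]
    calc ∫⁻ x, ENNReal.ofReal (g x ^ r - A ^ (r - 1) * g x) ∂μ
        = ∫⁻ x, ENNReal.ofReal (g x ^ (r - 1) - A ^ (r - 1))
            ∂μ.withDensity fun x => ENNReal.ofReal (g x) := by
          rw [lintegral_withDensity_eq_lintegral_mul _ hg.ennreal_ofReal
            ((hg.pow_const _).sub_const _).ennreal_ofReal]
          refine lintegral_congr fun x => ?_
          rw [Pi.mul_apply, ← ENNReal.ofReal_mul (hg0 x).le, hsplit]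
      _ = ∫⁻ t in Ioi (0 : ℝ), (∫⁻ x in {x | t + A < g x}, ENNReal.ofReal (g x) ∂μ) *
            ENNReal.ofReal ((r - 1) * (t + A) ^ (r - 1 - 1)) := by
          rw [hcake _ _ hr1]
          refine lintegral_congr fun t => ?_
          rw [withDensity_apply _ (measurableSet_lt measurable_const hg)]
      _ ≤ ∫⁻ t in Ioi (0 : ℝ), ENNReal.ofReal (δ * (r - 1) / r) *
            (μ {x | t + A < g x} * ENNReal.ofReal (r * (t + A) ^ (r - 1))) := by
          refine setLIntegral_mono' measurableSet_Ioi fun t ht => ?_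
          have ht : 0 < t := ht
          refine (mul_le_mul_left (hlevel (t + A) (by linarith)) _).trans (le_of_eq ?_)
          have h1 : δ * (t + A) * ((r - 1) * (t + A) ^ (r - 1 - 1)) =
              δ * (r - 1) / r * (r * (t + A) ^ (r - 1)) := by
            rw [show (t + A) ^ (r - 1) = (t + A) ^ (r - 1 - 1) * (t + A) by
              rw [← Real.rpow_add_one (by positivity)]; ring_nf]
            field_simp
          rw [← ENNReal.ofReal_mul hδ, mul_right_comm, ← ENNReal.ofReal_mul (by positivity), h1,
            ENNReal.ofReal_mul (by positivity)]
          ring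
      _ = _ := by
          rw [lintegral_const_mul' _ _ ENNReal.ofReal_ne_top, ← hcake μ r hr0]
  rw [ENNReal.ofReal_le_ofReal_iff (mul_nonneg (by positivity) (integral_nonneg (hmono r hr0.le))),
    integral_sub (hint r hr0.le) (hI1.const_mul _), integral_sub (hint r hr0.le)
    (integrable_const _), integral_const, integral_const_mul, smul_eq_mul] at key
  set Y := ∫ x, g x ^ r ∂μ
  set G := ∫ x, g x ∂μ
  set V := μ.real univ
  have hAr : A ^ r = A ^ (r - 1) * A := by
    rw [← Real.rpow_add_one hA.ne']; ring_nf
  have hB : 0 < A ^ (r - 1) := by positivity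
  rw [hAr] at key ⊢
  have h1 : r * (Y - A ^ (r - 1) * G) ≤ δ * (r - 1) * (Y - V * (A ^ (r - 1) * A)) := by
    have := mul_le_mul_of_nonneg_left key hr0.le
    calc _ ≤ _ := this
      _ = _ := by field_simp
  have h2 := mul_le_mul_of_nonneg_left hmean (mul_pos hr0 hB).le
  have h3 : (δ - (δ - 1) * r) * Y ≤ δ * (A ^ (r - 1) * A * V) := by linarith
  rw [mul_one_div, div_mul_eq_mul_div, le_div_iff₀ hδr]
  linarith

/-- Reverse Hölder inequality for the truncations of a Fujii–Wilson weight whose average over the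
interval is `A`. -/
lemma setLIntegral_min_rpow_le {w : ℝ → ℝ} (hw : ∀ x, 0 ≤ w x)
    (hloc : LocallyIntegrable w volume) {δ : ℝ} (hδ : 1 < δ)
    (hFW : ∀ a b : ℝ, a < b →
      (∫⁻ x in Ioo a b, M1 ((Ioo a b).indicator w) x) ≤
        ENNReal.ofReal δ * ∫⁻ x in Ioo a b, ENNReal.ofReal (w x))
    {a b : ℝ} (hab : a < b) {r : ℝ} (hr : 1 ≤ r) (hδr : 0 < δ - (δ - 1) * r) {A N : ℝ}
    (hA : 0 < A) (hAN : A ≤ N)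
    (hmean : (∫⁻ x in Ioo a b, ENNReal.ofReal (w x)) / volume (Ioo a b) = ENNReal.ofReal A) :
    ∫⁻ x in Ioo a b, ENNReal.ofReal (min (w x) N ^ r) ≤
      ENNReal.ofReal (δ * (1 / (δ - (δ - 1) * r))) * ENNReal.ofReal A ^ r *
        volume (Ioo a b) := by
  set m := M1 ((Ioo a b).indicator w) with hm
  set V := volume.real (Ioo a b) with hV
  have hVol : volume (Ioo a b) = ENNReal.ofReal V := by simp [hV, Measure.real]
  have hVpos : 0 < V := by simp [hV, hab]
  have hN : 0 < N := hA.trans_le hAN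
  have hδ0 : 0 ≤ δ := by linarith
  have hAm : ∀ x ∈ Ioo a b, ENNReal.ofReal A ≤ m x := fun x hx => by
    have := average_le_M1 ((Ioo a b).indicator w) hx
    rwa [setLIntegral_abs_indicator hw measurableSet_Ioo, inter_self, hmean] at this
  have htop : ∀ x, min (m x) (ENNReal.ofReal N) ≠ ∞ := fun x =>
    ((min_le_right _ _).trans_lt ENNReal.ofReal_lt_top).ne
  set g : ℝ → ℝ := fun x => max A (min (m x) (ENNReal.ofReal N)).toReal with hg
  have hgmeas : Measurable g :=
    measurable_const.max ((measurable_M1 _).min measurable_const).ennreal_toReal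
  have hAg : ∀ x, A ≤ g x := fun x => le_max_left _ _
  have hgN : ∀ x, g x ≤ N := fun x =>
    max_le hAN (ENNReal.toReal_le_of_le_ofReal hN.le (min_le_right _ _))
  have hg0 : ∀ x, 0 ≤ g x := fun x => hA.le.trans (hAg x)
  have hgm : ∀ x ∈ Ioo a b, ENNReal.ofReal (g x) ≤ m x := fun x hx => by
    rw [hg, ENNReal.ofReal_max, ENNReal.ofReal_toReal (htop x)]
    exact max_le (hAm x hx) (min_le_left _ _)
  have hgint : ∀ s : ℝ, 0 ≤ s → Integrable (fun x => g x ^ s) (volume.restrict (Ioo a b)) :=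
    fun s hs => by
    refine Integrable.of_bound (hgmeas.pow_const s).aestronglyMeasurable (N ^ s)
      (ae_of_all _ fun x => ?_)
    rw [Real.norm_of_nonneg (Real.rpow_nonneg (hg0 x) s)]
    exact Real.rpow_le_rpow (hg0 x) (hgN x) hs
  have hw_eq : ∫⁻ x in Ioo a b, ENNReal.ofReal (w x) = ENNReal.ofReal (A * V) := by
    rw [ENNReal.ofReal_mul hA.le, ← hmean, hVol, ENNReal.div_mul_cancel] <;> simp [hVpos]
  have hg_mean : ∫ x in Ioo a b, g x ≤ δ * A * (volume.restrict (Ioo a b)).real univ := by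
    rw [measureReal_restrict_apply_univ, ← hV, ← ENNReal.ofReal_le_ofReal_iff (by positivity),
      ofReal_integral_eq_lintegral_ofReal (by simpa using hgint 1 zero_le_one) (ae_of_all _ hg0)]
    calc ∫⁻ x in Ioo a b, ENNReal.ofReal (g x)
        ≤ ∫⁻ x in Ioo a b, m x := setLIntegral_mono' measurableSet_Ioo hgm
      _ ≤ _ := hFW a b hab
      _ = _ := by rw [hw_eq, ← ENNReal.ofReal_mul hδ0, mul_assoc]
  have hg_level : ∀ t, A ≤ t →
      ∫⁻ x in {x | t < g x}, ENNReal.ofReal (g x) ∂volume.restrict (Ioo a b) ≤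
        ENNReal.ofReal δ * ENNReal.ofReal t * volume.restrict (Ioo a b) {x | t < g x} := by
    intro t ht
    have hmeas : MeasurableSet {x | t < g x} := measurableSet_lt measurable_const hgmeas
    rw [Measure.restrict_restrict hmeas, Measure.restrict_apply hmeas]
    rcases le_or_gt N t with hNt | htN
    · have : {x | t < g x} = ∅ := eq_empty_of_forall_notMem fun x hx =>
        (hx.trans_le ((hgN x).trans hNt)).false
      simp [this]
    · have hset : {x | t < g x} = {x | ENNReal.ofReal t < m x} := by
        ext x
        simp only [hg, mem_ofPred_eq, lt_max_iff, not_lt.2 ht, false_or]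
        rw [← ENNReal.ofReal_lt_iff_lt_toReal (hA.le.trans ht) (htop x), lt_min_iff]
        exact and_iff_left ((ENNReal.ofReal_lt_ofReal_iff hN).2 htN)
      rw [hset, inter_comm]
      refine le_trans (setLIntegral_mono' ?_ fun x hx => hgm x hx.1)
        (setLIntegral_lt_M1_le hw hFW (hmean.le.trans (ENNReal.ofReal_le_ofReal ht)))
      exact measurableSet_Ioo.inter (isOpen_lt_M1 _ _).measurableSet
  have hRH := integral_rpow_le_of_setLIntegral_lt_le (volume.restrict (Ioo a b)) hgmeas hA hAg hgN
    hδ0 hr hδr hg_mean hg_level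
  have hr0 : 0 ≤ r := by linarith
  rw [measureReal_restrict_apply_univ, ← hV] at hRH
  calc ∫⁻ x in Ioo a b, ENNReal.ofReal (min (w x) N ^ r)
      ≤ ∫⁻ x in Ioo a b, ENNReal.ofReal (g x ^ r) := by
        refine lintegral_mono_ae ?_
        filter_upwards [ae_ofReal_le_M1_indicator hw hloc a b] with x hx
        refine ENNReal.ofReal_le_ofReal (Real.rpow_le_rpow (le_min (hw x) hN.le) ?_ hr0)
        refine le_max_of_le_right ((ENNReal.ofReal_le_iff_le_toReal (htop x)).1 ?_)
        rw [ENNReal.ofReal_min]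
        exact min_le_min_right _ hx
    _ = ENNReal.ofReal (∫ x in Ioo a b, g x ^ r) :=
        (ofReal_integral_eq_lintegral_ofReal (hgint r hr0)
          (ae_of_all _ fun x => Real.rpow_nonneg (hg0 x) r)).symm
    _ ≤ ENNReal.ofReal (δ * (1 / (δ - (δ - 1) * r)) * (A ^ r * V)) :=
        ENNReal.ofReal_le_ofReal hRH
    _ = _ := by
        rw [hVol, ENNReal.ofReal_rpow_of_pos hA, ← ENNReal.ofReal_mul (by positivity),
          ← ENNReal.ofReal_mul (by positivity), mul_assoc _ (A ^ r)]

/-- Sharp reverse Hölder inequality for an `A∞` weight on `ℝ` with Fujii–Wilson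
constant at most `δ`.  The constant `δ (r'-1)/(r'-δ)` is written in the equivalent
form `δ / (δ - (δ-1) r)`, valid also at `r = 1`. -/
theorem stmt2 (w : ℝ → ℝ) (hw : ∀ x, 0 ≤ w x) (hloc : LocallyIntegrable w volume)
    (δ : ℝ) (hδ : 1 < δ)
    (hFW : ∀ a b : ℝ, a < b →
      (∫⁻ x in Set.Ioo a b, M1 ((Set.Ioo a b).indicator w) x) ≤
        ENNReal.ofReal δ * ∫⁻ x in Set.Ioo a b, ENNReal.ofReal (w x))
    (a b : ℝ) (hab : a < b) (r : ℝ) (hr1 : 1 ≤ r) (hr2 : r < δ / (δ - 1)) :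
    (∫⁻ x in Set.Ioo a b, ENNReal.ofReal (w x ^ r)) / volume (Set.Ioo a b) ≤
      ENNReal.ofReal (δ * (1 / (δ - (δ - 1) * r))) *
        ((∫⁻ x in Set.Ioo a b, ENNReal.ofReal (w x)) / volume (Set.Ioo a b)) ^ r := by
  have hδr : 0 < δ - (δ - 1) * r := by
    rw [lt_div_iff₀ (by linarith)] at hr2
    linarith
  have hr0 : 0 < r := by linarith
  have hint : IntegrableOn w (Ioo a b) :=
    (hloc.integrableOn_isCompact isCompact_Icc).mono_set Ioo_subset_Icc_self
  have hwm : AEMeasurable w (volume.restrict (Ioo a b)) := hint.aemeasurable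
  have hVol0 : volume (Ioo a b) ≠ 0 := by simpa using hab
  have hVolt : volume (Ioo a b) ≠ ∞ := by simp
  have hWt : ∫⁻ x in Ioo a b, ENNReal.ofReal (w x) ≠ ∞ := hint.lintegral_lt_top.ne
  set A := ((∫⁻ x in Ioo a b, ENNReal.ofReal (w x)) / volume (Ioo a b)).toReal
  have hmean : (∫⁻ x in Ioo a b, ENNReal.ofReal (w x)) / volume (Ioo a b) = ENNReal.ofReal A :=
    (ENNReal.ofReal_toReal (ENNReal.div_ne_top hWt hVol0)).symm
  have hA_nonneg : 0 ≤ A := ENNReal.toReal_nonneg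
  rcases hA_nonneg.eq_or_lt with hA0 | hA0
  · rw [← hA0, ENNReal.ofReal_zero, ENNReal.div_eq_zero_iff, or_iff_left hVolt,
      lintegral_eq_zero_iff' hwm.ennreal_ofReal] at hmean
    have : ∫⁻ x in Ioo a b, ENNReal.ofReal (w x ^ r) = 0 := by
      rw [lintegral_eq_zero_iff' (hwm.pow_const r).ennreal_ofReal]
      filter_upwards [hmean] with x hx
      have hx0 : w x = 0 := le_antisymm (ENNReal.ofReal_eq_zero.1 hx) (hw x)
      simp [hx0, hr0.ne']
    simp [this]
  · rw [hmean, ENNReal.div_le_iff hVol0 hVolt]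
    have hlim : Filter.Tendsto
        (fun n : ℕ => ∫⁻ x in Ioo a b, ENNReal.ofReal (min (w x) n ^ r)) Filter.atTop
        (nhds (∫⁻ x in Ioo a b, ENNReal.ofReal (w x ^ r))) := by
      refine lintegral_tendsto_of_tendsto_of_monotone
        (fun n => ((hwm.min aemeasurable_const).pow_const r).ennreal_ofReal)
        (ae_of_all _ fun x n k hnk => ENNReal.ofReal_le_ofReal (Real.rpow_le_rpow
          (le_min (hw x) n.cast_nonneg) (min_le_min_left _ (Nat.cast_le.2 hnk)) hr0.le))
        (ae_of_all _ fun x => tendsto_const_nhds.congr' ?_)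
      obtain ⟨n, hn⟩ := exists_nat_ge (w x)
      filter_upwards [Filter.eventually_ge_atTop n] with k hk
      rw [min_eq_left (hn.trans (Nat.cast_le.2 hk))]
    refine le_of_tendsto hlim ?_
    obtain ⟨n, hn⟩ := exists_nat_ge A
    filter_upwards [Filter.eventually_ge_atTop n] with k hk
    exact setLIntegral_min_rpow_le hw hloc hδ hFW hab hr1 hδr hA0
      (hn.trans (Nat.cast_le.2 hk)) hmean
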